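/- There exist absolute constants ε > 0 and Δ₀ such that every multigraph F with maximum degree Δ(F) ≥ Δ₀ has strong chromatic index χ'ₛ(F) ≤ (2 − ε)Δ(F)². -/

import Mathlib

open Finset

/-- In a multigraph given by an edge type `E` with endpoint map `ends`,
two edges share an endpoint. -/
def Share {V E : Type*} (ends : E → Sym2 V) (e f : E) : Prop :=
  ∃ v : V, v ∈ ends e ∧ v ∈ ends f

/-- The degree of a vertex in a multigraph. -/
noncomputable def mDeg {V E : Type*} (ends : E → Sym2 V) (v : V) : ℕ :=
  Set.ncard {e : E | v ∈ ends e}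

/-- The degree of an edge `e` in the square of the line graph of the multigraph:
the number of other edges sharing an endpoint with `e` or with an edge
sharing an endpoint with `e`. -/
noncomputable def lineSqDeg {V E : Type*} (ends : E → Sym2 V) (e : E) : ℕ :=
  Set.ncard {f : E | f ≠ e ∧ (Share ends e f ∨ ∃ g : E, Share ends e g ∧ Share ends g f)}

/-- A strong edge-colouring with `n` colours: edges at distance at most two
in the line graph get distinct colours. -/
def IsStrongEdgeColouring {V E : Type*} (ends : E → Sym2 V) (n : ℕ) (c : E → Fin n) : Prop :=
  ∀ e f : E, e ≠ f →
    (Share ends e f ∨ ∃ g : E, Share ends e g ∧ Share ends g f) → c e ≠ c f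

/-! ### Moment computations -/

theorem card_val_zero (M : ℕ) (hM : 1 ≤ M) : #{t : Fin M | t.val = 0} = 1 := by
  rw [card_eq_one]
  refine ⟨⟨0, hM⟩, ?_⟩
  ext t
  simp [Fin.ext_iff]

theorem card_val_ne_zero (M : ℕ) (hM : 1 ≤ M) : #{t : Fin M | t.val ≠ 0} = M - 1 := by
  have := Finset.card_filter_add_card_filter_not (s := (univ : Finset (Fin M)))
    (fun t : Fin M => t.val = 0)
  rw [card_val_zero M hM, card_univ, Fintype.card_fin] at this
  simp only [ne_eq]
  omega

/-- Exponential moment of the excess multiplicity of a single vertex. -/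
theorem excess_moment (C M : ℕ) (hM : 1 ≤ M) :
    ∑ τ : Fin C → Fin M, (2 : ℝ) ^ (#{c | (τ c).val = 0} - 1)
      ≤ (M : ℝ) ^ C * Real.exp (((C : ℝ) / M) ^ 2 / 2) := by
  have hM0 : (0 : ℝ) < M := by exact_mod_cast hM
  have e1 : ∀ τ : Fin C → Fin M, (2 : ℝ) ^ (#{c | (τ c).val = 0} - 1)
      = ((∏ c, if (τ c).val = 0 then (2 : ℝ) else 1)
        + ∏ c, if (τ c).val = 0 then (0 : ℝ) else 1) / 2 := by
    intro τ
    rw [Finset.prod_ite, Finset.prod_ite]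
    simp only [prod_const, one_pow, mul_one]
    rcases Nat.eq_zero_or_pos (#{c | (τ c).val = 0}) with h | h
    · rw [h]; norm_num
    · obtain ⟨k, hk⟩ := Nat.exists_eq_succ_of_ne_zero h.ne'
      rw [hk]
      simp [pow_succ]
  have s1 : ∑ τ : Fin C → Fin M, (∏ c, if (τ c).val = 0 then (2 : ℝ) else 1)
      = ((M : ℝ) + 1) ^ C := by
    have := Finset.prod_univ_sum (fun _ : Fin C => (univ : Finset (Fin M)))
      (fun _ t => if t.val = 0 then (2 : ℝ) else 1)
    rw [Fintype.piFinset_univ] at this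
    rw [← this]
    have h : ∑ t : Fin M, (if t.val = 0 then (2 : ℝ) else 1) = M + 1 := by
      rw [Finset.sum_ite]
      have h1 := card_val_zero M hM
      have h2 := card_val_ne_zero M hM
      simp only [ne_eq] at h2
      simp only [sum_const, h1, h2, nsmul_eq_mul]
      push_cast [Nat.cast_sub hM]
      ring
    simp [h]
  have s2 : ∑ τ : Fin C → Fin M, (∏ c, if (τ c).val = 0 then (0 : ℝ) else 1)
      = ((M : ℝ) - 1) ^ C := by
    have := Finset.prod_univ_sum (fun _ : Fin C => (univ : Finset (Fin M)))
      (fun _ t => if t.val = 0 then (0 : ℝ) else 1)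
    rw [Fintype.piFinset_univ] at this
    rw [← this]
    have h : ∑ t : Fin M, (if t.val = 0 then (0 : ℝ) else 1) = M - 1 := by
      rw [Finset.sum_ite]
      have h2 := card_val_ne_zero M hM
      simp only [ne_eq] at h2
      simp only [sum_const, h2, nsmul_eq_mul]
      push_cast [Nat.cast_sub hM]
      ring
    simp [h]
  rw [Finset.sum_congr rfl (fun τ _ => e1 τ), ← Finset.sum_div, Finset.sum_add_distrib, s1, s2]
  have b1 : ((M : ℝ) + 1) ^ C ≤ (M : ℝ) ^ C * Real.exp ((C : ℝ) / M) := by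
    have : (M : ℝ) + 1 ≤ M * Real.exp (1 / M) := by
      have := Real.add_one_le_exp (1 / (M : ℝ))
      calc (M : ℝ) + 1 = M * (1 / M + 1) := by field_simp; ring
        _ ≤ _ := by gcongr
    calc ((M : ℝ) + 1) ^ C ≤ (M * Real.exp (1 / M)) ^ C := by gcongr
      _ = _ := by rw [mul_pow, ← Real.exp_nat_mul]; congr 2; ring
  have b2 : ((M : ℝ) - 1) ^ C ≤ (M : ℝ) ^ C * Real.exp (-((C : ℝ) / M)) := by
    have h1 : (1 : ℝ) ≤ M := by exact_mod_cast hM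
    have : (M : ℝ) - 1 ≤ M * Real.exp (-(1 / M)) := by
      have := Real.add_one_le_exp (-(1 / (M : ℝ)))
      calc (M : ℝ) - 1 = M * (-(1 / M) + 1) := by field_simp; ring
        _ ≤ _ := by gcongr
    calc ((M : ℝ) - 1) ^ C ≤ (M * Real.exp (-(1 / M))) ^ C := by
            apply pow_le_pow_left₀ (by linarith) this
      _ = _ := by rw [mul_pow, ← Real.exp_nat_mul]; congr 2; ring
  calc _ ≤ ((M : ℝ) ^ C * Real.exp ((C : ℝ) / M) + (M : ℝ) ^ C * Real.exp (-((C : ℝ) / M))) / 2 := by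
        gcongr
    _ = (M : ℝ) ^ C * Real.cosh ((C : ℝ) / M) := by rw [Real.cosh_eq]; ring
    _ ≤ _ := by
      gcongr
      exact Real.cosh_le_exp_half_sq _

/-- Upper tail of the total excess on a set of vertices. -/
theorem excess_tail {V : Type*} [Fintype V] [DecidableEq V] (N : Finset V) (C M B : ℕ)
    (hM : 1 ≤ M) (hB : (#N : ℝ) * ((C : ℝ) / M) ^ 2 ≤ B) :
    (#{ω : V → Fin C → Fin M | B ≤ ∑ x ∈ N, (#{c | (ω x c).val = 0} - 1)} : ℝ)
      ≤ (Real.exp (1 / 2) / 2) ^ B * Fintype.card (V → Fin C → Fin M) := by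
  have hM0 : (0 : ℝ) < M := by exact_mod_cast hM
  have s1 : ∑ ω : V → Fin C → Fin M, (2 : ℝ) ^ (∑ x ∈ N, (#{c | (ω x c).val = 0} - 1))
      ≤ Real.exp (B / 2) * Fintype.card (V → Fin C → Fin M) := by
    have e : ∀ ω : V → Fin C → Fin M, (2 : ℝ) ^ (∑ x ∈ N, (#{c | (ω x c).val = 0} - 1))
        = ∏ x, if x ∈ N then (2 : ℝ) ^ (#{c | (ω x c).val = 0} - 1) else 1 := by
      intro ω
      rw [← Finset.prod_pow_eq_pow_sum, Finset.prod_ite_mem, Finset.univ_inter]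
    have := Finset.prod_univ_sum (fun _ : V => (univ : Finset (Fin C → Fin M)))
      (fun x τ => if x ∈ N then (2 : ℝ) ^ (#{c | (τ c).val = 0} - 1) else 1)
    rw [Fintype.piFinset_univ] at this
    rw [Finset.sum_congr rfl (fun ω _ => e ω), ← this]
    calc _ ≤ ∏ x : V, (M : ℝ) ^ C *
          (if x ∈ N then Real.exp (((C : ℝ) / M) ^ 2 / 2) else 1) := by
          apply Finset.prod_le_prod
          · intro x _
            apply Finset.sum_nonneg
            intro τ _
            split_ifs <;> positivity
          · intro x _
            by_cases hx : x ∈ N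
            · simp only [hx, if_true]
              exact excess_moment C M hM
            · simp [hx]
      _ = (∏ x ∈ N, Real.exp (((C : ℝ) / M) ^ 2 / 2)) * Fintype.card (V → Fin C → Fin M) := by
          rw [Finset.prod_mul_distrib, Finset.prod_ite_mem, Finset.univ_inter, mul_comm]
          simp
      _ ≤ _ := by
          gcongr
          rw [prod_const, ← Real.exp_nat_mul]
          apply Real.exp_le_exp.2
          linarith
  have s2 : (2 : ℝ) ^ B * (#{ω : V → Fin C → Fin M | B ≤ ∑ x ∈ N, (#{c | (ω x c).val = 0} - 1)} : ℝ)
      ≤ ∑ ω : V → Fin C → Fin M, (2 : ℝ) ^ (∑ x ∈ N, (#{c | (ω x c).val = 0} - 1)) := by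
    calc _ = ∑ ω ∈ {ω : V → Fin C → Fin M | B ≤ ∑ x ∈ N, (#{c | (ω x c).val = 0} - 1)},
          (2 : ℝ) ^ B := by rw [sum_const, nsmul_eq_mul, mul_comm]
      _ ≤ ∑ ω ∈ {ω : V → Fin C → Fin M | B ≤ ∑ x ∈ N, (#{c | (ω x c).val = 0} - 1)},
          (2 : ℝ) ^ (∑ x ∈ N, (#{c | (ω x c).val = 0} - 1)) := by
          apply sum_le_sum
          intro ω hω
          exact pow_le_pow_right₀ (by norm_num) (mem_filter.1 hω).2
      _ ≤ _ := by
          apply sum_le_sum_of_subset_of_nonneg (subset_univ _)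
          intros; positivity
  have h := s2.trans s1
  rw [div_pow, ← Real.exp_nat_mul, div_mul_eq_mul_div, le_div_iff₀ (by positivity)]
  calc _ = _ := mul_comm _ _
    _ ≤ _ := h
    _ = _ := by congr 2; ring

/-- Lower tail for the number of successful colours. -/
theorem success_tail {V : Type*} [Fintype V] [DecidableEq V] (C M B r : ℕ)
    (hM : 1 ≤ M) (hr : 1 ≤ r) (R : (V → Fin M) → Prop) [DecidablePred R]
    (hR : (Fintype.card (V → Fin M) : ℝ) ≤ r * #{η | R η}) (hC : C = 4 * r * B) :
    (#{ω : V → Fin C → Fin M | #{c | R (fun x => ω x c)} ≤ 2 * B} : ℝ)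
      ≤ (4 / Real.exp 2) ^ B * Fintype.card (V → Fin C → Fin M) := by
  have hr0 : (0 : ℝ) < r := by exact_mod_cast hr
  have hcard : (#{ω : V → Fin C → Fin M | #{c | R (fun x => ω x c)} ≤ 2 * B})
      = #{θ : Fin C → V → Fin M | #{c | R (θ c)} ≤ 2 * B} := by
    apply Finset.card_equiv (Equiv.piComm (fun (_ : V) (_ : Fin C) => Fin M))
    intro ω
    simp [Equiv.piComm]
  have hcard2 : Fintype.card (V → Fin C → Fin M) = Fintype.card (Fin C → V → Fin M) :=
    Fintype.card_congr (Equiv.piComm (fun (_ : V) (_ : Fin C) => Fin M))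
  rw [hcard, hcard2]
  have s1 : ∑ θ : Fin C → V → Fin M, ((1 : ℝ) / 2) ^ (#{c | R (θ c)})
      ≤ Real.exp (-(2 * B)) * Fintype.card (Fin C → V → Fin M) := by
    have e : ∀ θ : Fin C → V → Fin M, ((1 : ℝ) / 2) ^ (#{c | R (θ c)})
        = ∏ c, if R (θ c) then (1 : ℝ) / 2 else 1 := by
      intro θ
      rw [Finset.prod_ite]; simp
    have := Finset.prod_univ_sum (fun _ : Fin C => (univ : Finset (V → Fin M)))
      (fun _ η => if R η then (1 : ℝ) / 2 else 1)
    rw [Fintype.piFinset_univ] at this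
    rw [Finset.sum_congr rfl (fun ω _ => e ω), ← this, prod_const]
    have h1 : ∑ η : V → Fin M, (if R η then (1 : ℝ) / 2 else 1)
        ≤ Real.exp (-(1 / (2 * r))) * Fintype.card (V → Fin M) := by
      have hs : ∑ η : V → Fin M, (if R η then (1 : ℝ) / 2 else 1)
          = Fintype.card (V → Fin M) - (#{η | R η} : ℝ) / 2 := by
        have : ∀ η : V → Fin M, (if R η then (1 : ℝ) / 2 else 1)
            = 1 - (if R η then (1 : ℝ) else 0) / 2 := by
          intro η; split_ifs <;> norm_num
        rw [sum_congr rfl (fun η _ => this η), sum_sub_distrib, ← sum_div, Finset.sum_boole]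
        simp
      rw [hs]
      have := Real.add_one_le_exp (-(1 / (2 * (r : ℝ))))
      have h2 : (Fintype.card (V → Fin M) : ℝ) / r ≤ #{η | R η} := by
        rw [div_le_iff₀ hr0]; linarith
      calc (Fintype.card (V → Fin M) : ℝ) - (#{η | R η} : ℝ) / 2
          ≤ (-(1 / (2 * (r : ℝ))) + 1) * Fintype.card (V → Fin M) := by
            have : (1 / (2 * (r : ℝ))) * Fintype.card (V → Fin M)
              = (Fintype.card (V → Fin M) : ℝ) / r / 2 := by field_simp
            linarith
        _ ≤ _ := by gcongr
    calc _ ≤ (Real.exp (-(1 / (2 * r))) * Fintype.card (V → Fin M)) ^ #(univ : Finset (Fin C)) := by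
          apply pow_le_pow_left₀ _ h1
          apply sum_nonneg
          intros; split_ifs <;> norm_num
      _ = _ := by
          rw [mul_pow, ← Real.exp_nat_mul]
          congr 1
          · congr 1
            simp only [card_univ, Fintype.card_fin, hC]
            push_cast
            field_simp
            ring
          · simp
  have s2 : ((1 : ℝ) / 2) ^ (2 * B) * (#{θ : Fin C → V → Fin M | #{c | R (θ c)} ≤ 2 * B} : ℝ)
      ≤ ∑ θ : Fin C → V → Fin M, ((1 : ℝ) / 2) ^ (#{c | R (θ c)}) := by
    calc _ = ∑ θ ∈ {θ : Fin C → V → Fin M | #{c | R (θ c)} ≤ 2 * B},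
          ((1 : ℝ) / 2) ^ (2 * B) := by rw [sum_const, nsmul_eq_mul, mul_comm]
      _ ≤ ∑ θ ∈ {θ : Fin C → V → Fin M | #{c | R (θ c)} ≤ 2 * B},
          ((1 : ℝ) / 2) ^ (#{c | R (θ c)}) := by
          apply sum_le_sum
          intro ω hω
          exact pow_le_pow_of_le_one (by norm_num) (by norm_num) (mem_filter.1 hω).2
      _ ≤ _ := by
          apply sum_le_sum_of_subset_of_nonneg (subset_univ _)
          intros; positivity
  have h := s2.trans s1
  have e4 : ((1 : ℝ) / 2) ^ (2 * B) = 1 / 4 ^ B := by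
    rw [pow_mul, one_div_pow, one_div_pow]; norm_num
  have e5 : (4 / Real.exp 2) ^ B = 4 ^ B * Real.exp (-(2 * B)) := by
    rw [div_pow, ← Real.exp_nat_mul, Real.exp_neg, div_eq_mul_inv]
    congr 3; ring
  rw [e4, one_div, inv_mul_le_iff₀ (by positivity)] at h
  rw [e5, mul_assoc]
  exact h

/-- Probability that a random sparse set contains two vertices of `N`, both isolated. -/
theorem success_prob {V : Type*} [Fintype V] [DecidableEq V] (G : SimpleGraph V)
    [DecidableRel G.Adj] (v : V) (D M : ℕ) (hD : 1 ≤ D) (hM : M = 6 * D)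
    (hdeg : ∀ x, G.degree x ≤ D)
    (hP : D ^ 2 ≤ 16 * #{p ∈ G.neighborFinset v ×ˢ G.neighborFinset v |
      p.1 ≠ p.2 ∧ ¬ G.Adj p.1 p.2}) (R : (V → Fin M) → Prop) [DecidablePred R]
    (hR : ∀ η, (∃ x ∈ G.neighborFinset v, ∃ y ∈ G.neighborFinset v, x ≠ y ∧
      ((η x).val = 0 ∧ ∀ z, G.Adj x z → (η z).val ≠ 0) ∧
      ((η y).val = 0 ∧ ∀ z, G.Adj y z → (η z).val ≠ 0)) → R η) :
    (Fintype.card (V → Fin M) : ℝ) ≤ (2304 : ℕ) * #{η | R η} := by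
  have hM1 : 1 ≤ M := by omega
  have hM0 : (0 : ℝ) < M := by exact_mod_cast hM1
  set P := {p ∈ G.neighborFinset v ×ˢ G.neighborFinset v | p.1 ≠ p.2 ∧ ¬ G.Adj p.1 p.2} with hPdef
  let Z : V × V → Finset V := fun p =>
    (G.neighborFinset v ∪ G.neighborFinset p.1 ∪ G.neighborFinset p.2) \ {p.1, p.2}
  have hZ : ∀ p, #(Z p) ≤ 3 * D := by
    intro p
    have h1 := card_union_le (G.neighborFinset v ∪ G.neighborFinset p.1) (G.neighborFinset p.2)
    have h2 := card_union_le (G.neighborFinset v) (G.neighborFinset p.1)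
    have h3 : #(Z p) ≤ _ := card_le_card sdiff_subset
    have := hdeg v; have := hdeg p.1; have := hdeg p.2
    simp only [G.card_neighborFinset_eq_degree] at *
    omega
  let cyl : V × V → V → Finset (Fin M) := fun p z =>
    if z = p.1 ∨ z = p.2 then univ.filter (fun t : Fin M => t.val = 0)
    else if z ∈ Z p then univ.filter (fun t : Fin M => t.val ≠ 0) else univ
  let Ev : V × V → Finset (V → Fin M) := fun p => Fintype.piFinset (cyl p)
  have hEv : ∀ p ∈ P, ∀ η ∈ Ev p, (η p.1).val = 0 ∧ (η p.2).val = 0 ∧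
      ∀ z ∈ Z p, (η z).val ≠ 0 := by
    intro p hp η hη
    rw [Fintype.mem_piFinset] at hη
    refine ⟨?_, ?_, ?_⟩
    · simpa [cyl] using hη p.1
    · simpa [cyl] using hη p.2
    · intro z hz
      have hz' : ¬ (z = p.1 ∨ z = p.2) := by
        have := (mem_sdiff.1 hz).2
        simpa using this
      have := hη z
      simp only [cyl, hz', if_false, hz, if_true, mem_filter] at this
      exact this.2
  have hcount : ∀ p ∈ P, (Fintype.card (V → Fin M) : ℝ) ≤ 2 * M ^ 2 * #(Ev p) := by
    intro p hp
    have hne : p.1 ≠ p.2 := (mem_filter.1 hp).2.1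
    have hc : (#(Ev p) : ℝ) = ∏ z, (#(cyl p z) : ℝ) := by
      simp only [Ev]
      rw [Fintype.card_piFinset]; push_cast; rfl
    have hfac : ∀ z, (#(cyl p z) : ℝ) = M * ((if z ∈ ({p.1, p.2} : Finset V) then 1 / (M : ℝ) else 1)
        * (if z ∈ Z p then 1 - 1 / (M : ℝ) else 1)) := by
      intro z
      simp only [cyl]
      by_cases h1 : z = p.1 ∨ z = p.2
      · have : z ∉ Z p := by
          simp only [Z, mem_sdiff, not_and, not_not]; intro _; simpa using h1
        have h1' : z ∈ ({p.1, p.2} : Finset V) := by simpa using h1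
        rw [if_pos h1, if_pos h1', if_neg this, card_val_zero M hM1]
        field_simp; norm_num
      · have h1' : z ∉ ({p.1, p.2} : Finset V) := by simpa using h1
        rw [if_neg h1, if_neg h1']
        by_cases h2 : z ∈ Z p
        · rw [if_pos h2, if_pos h2, card_val_ne_zero M hM1, Nat.cast_sub hM1]
          field_simp; norm_num
        · rw [if_neg h2, if_neg h2]; simp
    rw [hc, prod_congr rfl (fun z _ => hfac z), prod_mul_distrib, prod_mul_distrib,
      prod_ite_mem, prod_ite_mem, univ_inter, univ_inter, prod_const, prod_const, prod_const,
      card_pair hne]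
    have hbern : (1 : ℝ) / 2 ≤ (1 - 1 / (M : ℝ)) ^ #(Z p) := by
      have hb := one_add_mul_le_pow (a := -(1 / (M : ℝ))) (by
        have : 1 / (M : ℝ) ≤ 1 := by
          rw [div_le_one hM0]; exact_mod_cast hM1
        linarith) (#(Z p))
      have h3 : (#(Z p) : ℝ) * (1 / (M : ℝ)) ≤ 1 / 2 := by
        rw [mul_one_div, div_le_iff₀ hM0]
        have : (#(Z p) : ℝ) ≤ 3 * D := by exact_mod_cast hZ p
        rw [hM]; push_cast; linarith
      calc (1 : ℝ) / 2 ≤ 1 + #(Z p) * (-(1 / (M : ℝ))) := by linarith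
        _ ≤ _ := hb
        _ = _ := by ring_nf
    have hcardV : (Fintype.card (V → Fin M) : ℝ) = (M : ℝ) ^ #(univ : Finset V) := by
      simp
    rw [hcardV]
    calc (M : ℝ) ^ #(univ : Finset V) = 2 * M ^ 2 * (M ^ #(univ : Finset V) *
          ((1 / M) ^ 2 * (1 / 2))) := by field_simp
      _ ≤ _ := by gcongr
  have hdouble : ∑ p ∈ P, #(Ev p) ≤ 2 * #{η | R η} := by
    have hsw : ∑ p ∈ P, #(Ev p) = ∑ η : V → Fin M, #{p ∈ P | η ∈ Ev p} := by
      have := Finset.sum_card_bipartiteAbove_eq_sum_card_bipartiteBelow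
        (s := P) (t := (univ : Finset (V → Fin M))) (fun p η => η ∈ Ev p)
      simp only [bipartiteAbove, bipartiteBelow] at this
      rw [← this]
      apply sum_congr rfl
      intro p _
      simp
    rw [hsw]
    have hpt : ∀ η : V → Fin M, #{p ∈ P | η ∈ Ev p} ≤ if R η then 2 else 0 := by
      intro η
      rcases Finset.eq_empty_or_nonempty {p ∈ P | η ∈ Ev p} with h | ⟨p, hp⟩
      · rw [h]; simp
      · obtain ⟨hpP, hpE⟩ := mem_filter.1 hp
        obtain ⟨h1, h2, h3⟩ := hEv p hpP η hpE
        obtain ⟨hpN, hne, hnadj⟩ := mem_filter.1 hpP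
        obtain ⟨hx, hy⟩ := mem_product.1 hpN
        have hRη : R η := by
          apply hR
          refine ⟨p.1, hx, p.2, hy, hne, ⟨h1, ?_⟩, ⟨h2, ?_⟩⟩
          · intro z hz
            apply h3
            simp only [Z, mem_sdiff, mem_union, SimpleGraph.mem_neighborFinset, mem_insert,
              mem_singleton, not_or]
            refine ⟨Or.inl (Or.inr hz), ?_, ?_⟩
            · rintro rfl; exact G.irrefl hz
            · rintro rfl; exact hnadj hz
          · intro z hz
            apply h3
            simp only [Z, mem_sdiff, mem_union, SimpleGraph.mem_neighborFinset, mem_insert,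
              mem_singleton, not_or]
            refine ⟨Or.inr hz, ?_, ?_⟩
            · rintro rfl; exact hnadj hz.symm
            · rintro rfl; exact G.irrefl hz
        rw [if_pos hRη]
        have hsub : {p ∈ P | η ∈ Ev p} ⊆ {(p.1, p.2), (p.2, p.1)} := by
          intro q hq
          obtain ⟨hqP, hqE⟩ := mem_filter.1 hq
          obtain ⟨k1, k2, -⟩ := hEv q hqP η hqE
          obtain ⟨hqN, hqne, -⟩ := mem_filter.1 hqP
          obtain ⟨qx, qy⟩ := mem_product.1 hqN
          have hin : ∀ z ∈ G.neighborFinset v, (η z).val = 0 → z = p.1 ∨ z = p.2 := by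
            intro z hz h0
            by_contra hcon
            refine h3 z ?_ h0
            simp only [Z, mem_sdiff, mem_union]
            exact ⟨Or.inl (Or.inl hz), by simpa using hcon⟩
          have a1 := hin _ qx k1
          have a2 := hin _ qy k2
          simp only [mem_insert, mem_singleton, Prod.ext_iff]
          grind
        exact (card_le_card hsub).trans card_le_two
    calc _ ≤ ∑ η : V → Fin M, (if R η then 2 else 0) := sum_le_sum (fun η _ => hpt η)
      _ = _ := by rw [← sum_filter, sum_const, smul_eq_mul, mul_comm]
  have hsum : (#P : ℝ) * Fintype.card (V → Fin M) ≤ 2 * M ^ 2 * (2 * #{η | R η}) := by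
    calc (#P : ℝ) * Fintype.card (V → Fin M) = ∑ p ∈ P, (Fintype.card (V → Fin M) : ℝ) := by
          rw [sum_const, nsmul_eq_mul]
      _ ≤ ∑ p ∈ P, 2 * (M : ℝ) ^ 2 * #(Ev p) := sum_le_sum hcount
      _ = 2 * (M : ℝ) ^ 2 * ((∑ p ∈ P, #(Ev p) : ℕ) : ℝ) := by rw [← mul_sum]; push_cast; rfl
      _ ≤ _ := by gcongr; exact_mod_cast hdouble
  have hP' : (D : ℝ) ^ 2 ≤ 16 * #P := by exact_mod_cast hP
  have hD0 : (0 : ℝ) < D := by exact_mod_cast hD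
  have hMD : (M : ℝ) = 6 * D := by rw [hM]; push_cast; ring
  have hfin : (D : ℝ) ^ 2 * Fintype.card (V → Fin M) ≤ D ^ 2 * ((2304 : ℕ) * #{η | R η}) := by
    calc (D : ℝ) ^ 2 * Fintype.card (V → Fin M) ≤ (16 * #P) * Fintype.card (V → Fin M) := by gcongr
      _ = 16 * (#P * Fintype.card (V → Fin M)) := by ring
      _ ≤ 16 * (2 * M ^ 2 * (2 * #{η | R η})) := by gcongr
      _ = _ := by rw [hMD]; push_cast; ring
  exact le_of_mul_le_mul_left hfin (by positivity)
/-! ### The local lemma (symmetric version, uniform product space) -/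

theorem indep_count {V κ : Type*} [Fintype V] [DecidableEq V] [Fintype κ] [DecidableEq κ]
    (S : Finset V) (A B : Finset (V → κ))
    (hA : ∀ ω ω' : V → κ, (∀ x ∈ S, ω x = ω' x) → ω ∈ A → ω' ∈ A)
    (hB : ∀ ω ω' : V → κ, (∀ x, x ∉ S → ω x = ω' x) → ω ∈ B → ω' ∈ B) :
    #(A ∩ B) * Fintype.card (V → κ) = #A * #B := by
  rw [← Finset.card_univ, ← Finset.card_product, ← Finset.card_product]
  let mix : (V → κ) × (V → κ) → (V → κ) × (V → κ) := fun p =>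
    (fun x => if x ∈ S then p.1 x else p.2 x, fun x => if x ∈ S then p.2 x else p.1 x)
  have hmix : ∀ p, mix (mix p) = p := by
    intro p
    apply Prod.ext <;> funext x <;> by_cases hx : x ∈ S <;> simp [mix, hx]
  refine Finset.card_nbij' mix mix ?_ ?_ (fun p _ => hmix p) (fun p _ => hmix p)
  · intro p hp
    simp only [coe_product, Set.mem_prod, mem_coe, mem_inter] at hp ⊢
    refine ⟨hA p.1 _ ?_ hp.1.1, hB p.1 _ ?_ hp.1.2⟩
    · intro x hx; simp [mix, hx]
    · intro x hx; simp [mix, hx]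
  · intro p hp
    simp only [coe_product, Set.mem_prod, mem_coe, mem_inter] at hp ⊢
    refine ⟨⟨hA p.1 _ ?_ hp.1, hB p.2 _ ?_ hp.2⟩, mem_univ _⟩
    · intro x hx; simp [mix, hx]
    · intro x hx; simp [mix, hx]

theorem local_lemma {V κ J : Type*} [Fintype V] [DecidableEq V] [Fintype κ] [DecidableEq κ]
    [Nonempty κ] [Fintype J] [DecidableEq J]
    (Bad : J → Finset (V → κ)) (S : J → Finset V)
    (hS : ∀ j, ∀ ω ω' : V → κ, (∀ x ∈ S j, ω x = ω' x) → ω ∈ Bad j → ω' ∈ Bad j)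
    (d : ℕ) (hd0 : 1 ≤ d) (hd : ∀ j, #{k | ¬ Disjoint (S j) (S k)} ≤ d)
    (hp : ∀ j, 4 * d * #(Bad j) ≤ Fintype.card (V → κ)) :
    ∃ ω, ∀ j, ω ∉ Bad j := by
  classical
  let Av : Finset J → Finset (V → κ) := fun T => univ.filter (fun ω => ∀ j ∈ T, ω ∉ Bad j)
  have hΩ : 0 < Fintype.card (V → κ) := Fintype.card_pos
  have key : ∀ n : ℕ, ∀ T : Finset J, #T = n → ∀ j, 2 * d * #(Bad j ∩ Av T) ≤ #(Av T) := by
    intro n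
    induction n using Nat.strong_induction_on with
    | _ n ih =>
      intro T hT j
      let T1 := T.filter (fun k => ¬ Disjoint (S j) (S k))
      let T2 := T.filter (fun k => Disjoint (S j) (S k))
      have hT1 : #T1 ≤ d := le_trans (card_le_card (by intro k; simp [T1])) (hd j)
      have hind : #(Bad j ∩ Av T2) * Fintype.card (V → κ) = #(Bad j) * #(Av T2) := by
        apply indep_count (S j) _ _ (hS j)
        intro ω ω' h hω
        simp only [Av, mem_filter, mem_univ, true_and] at hω ⊢
        intro k hk hbad
        refine hω k hk (hS k ω' ω ?_ hbad)
        intro x hx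
        refine (h x ?_).symm
        intro hx'
        have : Disjoint (S j) (S k) := by simpa [T2] using (mem_filter.1 hk).2
        exact (Finset.disjoint_left.1 this) hx' hx
      have h1 : 4 * d * #(Bad j ∩ Av T2) ≤ #(Av T2) := by
        have := Nat.mul_le_mul_right (#(Av T2)) (hp j)
        have e : (4 * d * #(Bad j ∩ Av T2)) * Fintype.card (V → κ)
            ≤ #(Av T2) * Fintype.card (V → κ) := by
          calc _ = 4 * d * (#(Bad j ∩ Av T2) * Fintype.card (V → κ)) := by ring
            _ = 4 * d * #(Bad j) * #(Av T2) := by rw [hind]; ring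
            _ ≤ Fintype.card (V → κ) * #(Av T2) := this
            _ = _ := by ring
        exact Nat.le_of_mul_le_mul_right e hΩ
      have hsub : #(Bad j ∩ Av T) ≤ #(Bad j ∩ Av T2) := by
        apply card_le_card
        intro ω
        simp only [Av, T2, mem_inter, mem_filter, mem_univ, true_and]
        grind
      have h2 : #(Av T2) ≤ 2 * #(Av T) := by
        by_cases hne : T1 = ∅
        · have : T2 = T := by
            apply Finset.filter_true_of_mem
            intro k hk
            by_contra hcon
            have : k ∈ T1 := mem_filter.2 ⟨hk, hcon⟩
            simp [hne] at this
          rw [this]; omega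
        · have hlt : #T2 < n := by
            rw [← hT]
            apply card_lt_card
            obtain ⟨k, hk⟩ := nonempty_iff_ne_empty.2 hne
            refine Finset.filter_ssubset.2 ⟨k, (mem_filter.1 hk).1, (mem_filter.1 hk).2⟩
          have hcov : Av T2 ⊆ Av T ∪ T1.biUnion (fun k => Bad k ∩ Av T2) := by
            intro ω hω
            by_cases h : ω ∈ Av T
            · exact mem_union_left _ h
            · apply mem_union_right
              simp only [Av, mem_filter, mem_univ, true_and, not_forall, not_not] at h
              obtain ⟨k, hk, hb⟩ := h
              have hk1 : k ∈ T1 := by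
                refine mem_filter.2 ⟨hk, fun hdis => ?_⟩
                have := (mem_filter.1 hω).2 k (mem_filter.2 ⟨hk, hdis⟩)
                exact this hb
              exact mem_biUnion.2 ⟨k, hk1, mem_inter.2 ⟨hb, hω⟩⟩
          have hc := (card_le_card hcov).trans (card_union_le _ _)
          have hb : 2 * d * #(T1.biUnion (fun k => Bad k ∩ Av T2)) ≤ d * #(Av T2) := by
            calc 2 * d * #(T1.biUnion (fun k => Bad k ∩ Av T2))
                ≤ 2 * d * ∑ k ∈ T1, #(Bad k ∩ Av T2) := Nat.mul_le_mul_left _ card_biUnion_le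
              _ = ∑ k ∈ T1, 2 * d * #(Bad k ∩ Av T2) := by rw [mul_sum]
              _ ≤ ∑ k ∈ T1, #(Av T2) := sum_le_sum (fun k _ => ih _ hlt T2 rfl k)
              _ = #T1 * #(Av T2) := by simp
              _ ≤ _ := Nat.mul_le_mul_right _ hT1
          have hb' : 2 * #(T1.biUnion (fun k => Bad k ∩ Av T2)) ≤ #(Av T2) := by
            have : d * (2 * #(T1.biUnion (fun k => Bad k ∩ Av T2))) ≤ d * #(Av T2) := by
              calc _ = _ := by ring
                _ ≤ _ := hb
            exact Nat.le_of_mul_le_mul_left this hd0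
          omega
      have h3 := Nat.mul_le_mul_left (4 * d) hsub
      have h4 : 2 * (2 * d * #(Bad j ∩ Av T)) ≤ 2 * #(Av T) := by
        calc _ = 4 * d * #(Bad j ∩ Av T) := by ring
          _ ≤ _ := h3
          _ ≤ _ := h1
          _ ≤ _ := h2
      omega
  have pos : ∀ T : Finset J, 0 < #(Av T) := by
    intro T
    induction T using Finset.induction_on with
    | empty => simpa [Av] using hΩ
    | insert j T hj ih =>
      have hk := key _ T rfl j
      have hcov : Av T ⊆ Av (insert j T) ∪ (Bad j ∩ Av T) := by
        intro ω
        simp only [Av, mem_union, mem_inter, mem_filter, mem_univ, true_and, mem_insert]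
        grind
      have hc := (card_le_card hcov).trans (card_union_le _ _)
      have : 2 * #(Bad j ∩ Av T) ≤ 2 * d * #(Bad j ∩ Av T) := by
        apply Nat.mul_le_mul_right; omega
      omega
  obtain ⟨ω, hω⟩ := card_pos.1 (pos univ)
  exact ⟨ω, fun j => (mem_filter.1 hω).2 j (mem_univ j)⟩

/-! ### Colouring graphs with sparse neighbourhoods -/

theorem numeric_lll : ∃ B0 : ℕ, ∀ B : ℕ, B0 ≤ B →
    4 * ((2359296 * B + 1 : ℕ) : ℝ) ^ 4 *
      ((Real.exp (1 / 2) / 2) ^ B + (4 / Real.exp 2) ^ B) ≤ 1 := by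
  have h1 : |Real.exp (1 / 2) / 2| < 1 := by
    rw [abs_of_pos (by positivity), div_lt_one (by norm_num)]
    have h := Real.exp_one_lt_d9
    have hs : Real.exp (1 / 2) ^ 2 = Real.exp 1 := by
      rw [← Real.exp_nat_mul]; norm_num
    nlinarith [Real.exp_pos (1 / 2)]
  have h2 : |4 / Real.exp 2| < 1 := by
    rw [abs_of_pos (by positivity), div_lt_one (by positivity)]
    have h := Real.exp_one_gt_d9
    have hs : Real.exp 1 ^ 2 = Real.exp 2 := by
      rw [← Real.exp_nat_mul]; norm_num
    nlinarith
  have t1 := tendsto_pow_const_mul_const_pow_of_abs_lt_one 4 h1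
  have t2 := tendsto_pow_const_mul_const_pow_of_abs_lt_one 4 h2
  have t := (t1.add t2).const_mul (4 * (2359297 : ℝ) ^ 4)
  simp only [add_zero, mul_zero] at t
  have ev := t.eventually (ge_mem_nhds (show (0 : ℝ) < 1 by norm_num))
  obtain ⟨B0, hB0⟩ := Filter.eventually_atTop.1 ev
  refine ⟨max B0 1, fun B hB => ?_⟩
  have hb := hB0 B (le_trans (le_max_left _ _) hB)
  have hB1 : 1 ≤ B := le_trans (le_max_right _ _) hB
  refine le_trans ?_ hb
  have h3 : ((2359296 * B + 1 : ℕ) : ℝ) ≤ 2359297 * B := by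
    have : (2359296 * B + 1 : ℕ) ≤ 2359297 * B := by omega
    exact_mod_cast this
  have h4 : ((2359296 * B + 1 : ℕ) : ℝ) ^ 4 ≤ (2359297 * (B : ℝ)) ^ 4 := by gcongr
  calc _ ≤ 4 * (2359297 * (B : ℝ)) ^ 4 *
      ((Real.exp (1 / 2) / 2) ^ B + (4 / Real.exp 2) ^ B) := by gcongr
    _ = _ := by ring

theorem greedy_extend {V : Type*} [Fintype V] [DecidableEq V] (G : SimpleGraph V)
    [DecidableRel G.Adj] (K : ℕ) (dom : Finset V) (κ : V → Fin K)
    (hprop : ∀ x ∈ dom, ∀ y ∈ dom, G.Adj x y → κ x ≠ κ y)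
    (hv : ∀ v, v ∉ dom → #((G.neighborFinset v ∩ dom).image κ) + #(G.neighborFinset v \ dom) < K) :
    ∃ c : V → Fin K, ∀ x y, G.Adj x y → c x ≠ c y := by
  have key : ∀ U : Finset V, Disjoint U dom → ∃ c : V → Fin K, (∀ x ∈ dom, c x = κ x) ∧
      ∀ x ∈ dom ∪ U, ∀ y ∈ dom ∪ U, G.Adj x y → c x ≠ c y := by
    intro U
    induction U using Finset.induction_on with
    | empty => intro _; exact ⟨κ, fun _ _ => rfl, by simpa using hprop⟩
    | insert v U hvU ih =>
      intro hdis
      rw [disjoint_insert_left] at hdis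
      obtain ⟨c, hc, hcp⟩ := ih hdis.2
      have hused : #((G.neighborFinset v).image c) < K := by
        refine lt_of_le_of_lt ?_ (hv v hdis.1)
        have : (G.neighborFinset v).image c ⊆
            (G.neighborFinset v ∩ dom).image κ ∪ (G.neighborFinset v \ dom).image c := by
          intro t ht
          obtain ⟨x, hx, rfl⟩ := mem_image.1 ht
          by_cases hd : x ∈ dom
          · exact mem_union_left _ (mem_image.2 ⟨x, mem_inter.2 ⟨hx, hd⟩, (hc x hd).symm⟩)
          · exact mem_union_right _ (mem_image.2 ⟨x, mem_sdiff.2 ⟨hx, hd⟩, rfl⟩)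
        exact (card_le_card this).trans ((card_union_le _ _).trans
          (Nat.add_le_add_left card_image_le _))
      obtain ⟨t, ht⟩ : ∃ t : Fin K, t ∉ (G.neighborFinset v).image c := by
        by_contra hcon
        push Not at hcon
        have : (G.neighborFinset v).image c = univ := eq_univ_of_forall hcon
        rw [this, card_univ, Fintype.card_fin] at hused
        omega
      have ht' : ∀ y, G.Adj v y → c y ≠ t := by
        intro y hy h
        exact ht (mem_image.2 ⟨y, (G.mem_neighborFinset v y).2 hy, h⟩)
      refine ⟨Function.update c v t, ?_, ?_⟩
      · intro x hx
        rw [Function.update_of_ne (by rintro rfl; exact hdis.1 hx)]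
        exact hc x hx
      · intro x hx y hy hxy
        have hx' : x = v ∨ x ∈ dom ∪ U := by simp only [mem_union, mem_insert] at hx ⊢; tauto
        have hy' : y = v ∨ y ∈ dom ∪ U := by simp only [mem_union, mem_insert] at hy ⊢; tauto
        by_cases hxv : x = v
        · subst hxv
          have hyx : y ≠ x := hxy.ne'
          rw [Function.update_self, Function.update_of_ne hyx]
          exact (ht' y hxy).symm
        · by_cases hyv : y = v
          · subst hyv
            rw [Function.update_self, Function.update_of_ne hxv]
            exact ht' x hxy.symm
          · rw [Function.update_of_ne hxv, Function.update_of_ne hyv]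
            exact hcp x (hx'.resolve_left hxv) y (hy'.resolve_left hyv) hxy
  obtain ⟨c, -, hc⟩ := key (univ \ dom) sdiff_disjoint
  exact ⟨c, fun x y => hc x (by simp) y (by simp)⟩

/-- `x` is selected by colour `c` and no neighbour is. -/
def Ret {V : Type*} (G : SimpleGraph V) {C M : ℕ} (ω : V → Fin C → Fin M) (x : V) (c : Fin C) :
    Prop := (ω x c).val = 0 ∧ ∀ z, G.Adj x z → (ω z c).val ≠ 0

theorem savings {V : Type*} [Fintype V] [DecidableEq V] (N : Finset V) (C : ℕ)
    (ret : V → Fin C → Prop) [∀ x c, Decidable (ret x c)] (m : V → ℕ)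
    (hm : ∀ x, #{c | ret x c} ≤ m x) (dom : Finset V) (hdom : ∀ x, x ∈ dom ↔ ∃ c, ret x c)
    (κ : V → Fin C) (hκ : ∀ x ∈ dom, ret x (κ x)) :
    #((N ∩ dom).image κ) + #{c | ∃ x ∈ N, ∃ y ∈ N, x ≠ y ∧ ret x c ∧ ret y c}
      ≤ #(N ∩ dom) + ∑ x ∈ N, (m x - 1) := by
  have h1 : ∑ c : Fin C, #{x ∈ N | ret x c} = ∑ x ∈ N, #{c | ret x c} := by
    have := Finset.sum_card_bipartiteAbove_eq_sum_card_bipartiteBelow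
        (s := N) (t := (univ : Finset (Fin C))) (fun x c => ret x c)
    simp only [bipartiteAbove, bipartiteBelow] at this
    exact this.symm
  have h2 : ∑ x ∈ N, #{c | ret x c} ≤ #(N ∩ dom) + ∑ x ∈ N, (m x - 1) := by
    have : #(N ∩ dom) = ∑ x ∈ N, if x ∈ dom then 1 else 0 := by
      rw [← Finset.card_filter, Finset.filter_mem_eq_inter]
    rw [this, ← sum_add_distrib]
    apply sum_le_sum
    intro x _
    have := hm x
    by_cases hx : x ∈ dom
    · rw [if_pos hx]; omega
    · rw [if_neg hx]
      have : #{c | ret x c} = 0 := by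
        rw [card_eq_zero, filter_eq_empty_iff]
        intro c _ hc
        exact hx ((hdom x).2 ⟨c, hc⟩)
      omega
  have h3 : #((N ∩ dom).image κ) + #{c | ∃ x ∈ N, ∃ y ∈ N, x ≠ y ∧ ret x c ∧ ret y c}
      ≤ ∑ c : Fin C, #{x ∈ N | ret x c} := by
    have e1 : #((N ∩ dom).image κ) = ∑ c : Fin C, if c ∈ (N ∩ dom).image κ then 1 else 0 := by
      rw [← Finset.card_filter]; congr 1; ext; simp
    rw [e1, Finset.card_filter, ← sum_add_distrib]
    apply sum_le_sum
    intro c _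
    by_cases hc : ∃ x ∈ N, ∃ y ∈ N, x ≠ y ∧ ret x c ∧ ret y c
    · have : 2 ≤ #{x ∈ N | ret x c} := by
        obtain ⟨x, hx, y, hy, hxy, h1, h2⟩ := hc
        rw [← card_pair hxy]
        apply card_le_card
        intro z hz
        rcases mem_insert.1 hz with rfl | hz
        · exact mem_filter.2 ⟨hx, h1⟩
        · rw [mem_singleton.1 hz]; exact mem_filter.2 ⟨hy, h2⟩
      rw [if_pos hc]
      split_ifs <;> omega
    · rw [if_neg hc]
      split_ifs with hi
      · obtain ⟨x, hx, rfl⟩ := mem_image.1 hi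
        have hx' := mem_inter.1 hx
        have : 0 < #{z ∈ N | ret z (κ x)} :=
          card_pos.2 ⟨x, mem_filter.2 ⟨hx'.1, hκ x hx'.2⟩⟩
        omega
      · omega
  omega

set_option maxHeartbeats 1000000 in
theorem sparse_colouring : ∃ B0 : ℕ, ∀ B : ℕ, B0 ≤ B → ∀ (V : Type) [Fintype V] [DecidableEq V]
    (G : SimpleGraph V) [DecidableRel G.Adj], (∀ v, G.degree v ≤ 2359296 * B) →
    (∀ v, G.degree v + B < 2359296 * B ∨ (2359296 * B) ^ 2 ≤
      16 * #{p ∈ G.neighborFinset v ×ˢ G.neighborFinset v | p.1 ≠ p.2 ∧ ¬ G.Adj p.1 p.2}) →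
    ∃ c : V → Fin (2359296 * B - B), ∀ x y, G.Adj x y → c x ≠ c y := by
  obtain ⟨B0, hB0⟩ := numeric_lll
  refine ⟨max B0 1, fun B hB V _ _ G _ hdeg hsp => ?_⟩
  have hnum := hB0 B (le_trans (le_max_left _ _) hB)
  have hB1 : 1 ≤ B := le_trans (le_max_right _ _) hB
  classical
  obtain ⟨D, hD⟩ : ∃ D, D = 2359296 * B := ⟨_, rfl⟩
  obtain ⟨C, hC⟩ : ∃ C, C = 4 * 2304 * B := ⟨_, rfl⟩
  obtain ⟨M, hM⟩ : ∃ M, M = 6 * D := ⟨_, rfl⟩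
  rw [← hD] at hdeg hnum
  simp only [← hD] at hsp
  rw [← hD]
  have hM1 : 1 ≤ M := by omega
  have : Nonempty (Fin C → Fin M) := ⟨fun _ => ⟨0, hM1⟩⟩
  let ok : V → (V → Fin C → Fin M) → Prop := fun v ω =>
    G.degree v + B < D ∨
    (2 * B < #{c | ∃ x ∈ G.neighborFinset v, ∃ y ∈ G.neighborFinset v, x ≠ y ∧
        Ret G ω x c ∧ Ret G ω y c} ∧
      ∑ x ∈ G.neighborFinset v, (#{c | (ω x c).val = 0} - 1) < B)
  let nb : V → Finset V := fun v => insert v (G.neighborFinset v)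
  let S : V → Finset V := fun v => (nb v).biUnion nb
  have hnb : ∀ v, #(nb v) ≤ D + 1 := by
    intro v
    have := card_insert_le v (G.neighborFinset v)
    rw [G.card_neighborFinset_eq_degree] at this
    have := hdeg v
    simp only [nb]; omega
  have hScard : ∀ v, #(S v) ≤ (D + 1) ^ 2 := by
    intro v
    calc #(S v) ≤ ∑ x ∈ nb v, #(nb x) := card_biUnion_le
      _ ≤ ∑ x ∈ nb v, (D + 1) := sum_le_sum (fun x _ => hnb x)
      _ = #(nb v) * (D + 1) := by simp
      _ ≤ (D + 1) * (D + 1) := Nat.mul_le_mul_right _ (hnb v)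
      _ = _ := by ring
  have hnbs : ∀ x y, x ∈ nb y → y ∈ nb x := by
    intro x y
    simp only [nb, mem_insert, SimpleGraph.mem_neighborFinset]
    rintro (rfl | h)
    · exact Or.inl rfl
    · exact Or.inr h.symm
  have hSs : ∀ x y, x ∈ S y → y ∈ S x := by
    intro x y h
    obtain ⟨z, hz, hxz⟩ := mem_biUnion.1 h
    exact mem_biUnion.2 ⟨z, hnbs _ _ hxz, hnbs _ _ hz⟩
  have hloc : ∀ v, ∀ ω ω' : V → Fin C → Fin M, (∀ x ∈ S v, ω x = ω' x) → ok v ω' → ok v ω := by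
    intro v ω ω' h hok
    have hN : ∀ x ∈ G.neighborFinset v, ω x = ω' x := by
      intro x hx
      apply h
      exact mem_biUnion.2 ⟨x, mem_insert_of_mem hx, mem_insert_self _ _⟩
    have hNN : ∀ x ∈ G.neighborFinset v, ∀ z, G.Adj x z → ω z = ω' z := by
      intro x hx z hz
      apply h
      exact mem_biUnion.2 ⟨x, mem_insert_of_mem hx,
        mem_insert_of_mem ((G.mem_neighborFinset x z).2 hz)⟩
    have hRet : ∀ x ∈ G.neighborFinset v, ∀ c, Ret G ω' x c → Ret G ω x c := by
      intro x hx c hr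
      refine ⟨by rw [hN x hx]; exact hr.1, fun z hz => ?_⟩
      rw [hNN x hx z hz]; exact hr.2 z hz
    rcases hok with h1 | ⟨h1, h2⟩
    · exact Or.inl h1
    · refine Or.inr ⟨lt_of_lt_of_le h1 (card_le_card ?_), ?_⟩
      · intro c
        simp only [mem_filter, mem_univ, true_and]
        rintro ⟨x, hx, y, hy, hxy, hr1, hr2⟩
        exact ⟨x, hx, y, hy, hxy, hRet x hx c hr1, hRet y hy c hr2⟩
      · rw [sum_congr rfl (fun x hx => by rw [hN x hx])]
        exact h2
  obtain ⟨ω, hω⟩ := local_lemma (fun v => univ.filter (fun ω => ¬ ok v ω)) S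
    (by
      intro v ω ω' h hb
      simp only [mem_filter, mem_univ, true_and] at hb ⊢
      exact fun h' => hb (hloc v ω ω' h h'))
    ((D + 1) ^ 4) (Nat.one_le_pow _ _ (by omega))
    (by
      intro v
      have hsub : ({k | ¬ Disjoint (S v) (S k)} : Finset V) ⊆ (S v).biUnion S := by
        intro k hk
        obtain ⟨x, hx, hxk⟩ := Finset.not_disjoint_iff.1 (mem_filter.1 hk).2
        exact mem_biUnion.2 ⟨x, hx, hSs _ _ hxk⟩
      calc _ ≤ #((S v).biUnion S) := card_le_card hsub
        _ ≤ ∑ x ∈ S v, #(S x) := card_biUnion_le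
        _ ≤ ∑ x ∈ S v, (D + 1) ^ 2 := sum_le_sum (fun x _ => hScard x)
        _ = #(S v) * (D + 1) ^ 2 := by simp
        _ ≤ (D + 1) ^ 2 * (D + 1) ^ 2 := Nat.mul_le_mul_right _ (hScard v)
        _ = _ := by ring)
    (by
      intro v
      rcases hsp v with hlow | hP
      · have : (univ.filter (fun ω => ¬ ok v ω)) = ∅ := by
          rw [filter_eq_empty_iff]
          intro ω _ h
          exact h (Or.inl hlow)
        simp [this]
      · have hsub : (univ.filter (fun ω => ¬ ok v ω)) ⊆
            ({ω : V → Fin C → Fin M | B ≤ ∑ x ∈ G.neighborFinset v,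
              (#{c | (ω x c).val = 0} - 1)} : Finset (V → Fin C → Fin M)) ∪
            ({ω : V → Fin C → Fin M | #{c | ∃ x ∈ G.neighborFinset v,
              ∃ y ∈ G.neighborFinset v, x ≠ y ∧ Ret G ω x c ∧ Ret G ω y c} ≤ 2 * B} :
              Finset (V → Fin C → Fin M)) := by
          intro ω hω
          simp only [mem_filter, mem_univ, true_and, mem_union] at hω ⊢
          by_contra hcon
          push Not at hcon
          exact hω (Or.inr ⟨hcon.2, hcon.1⟩)
        have hc := (card_le_card hsub).trans (card_union_le _ _)
        have hc' := (Nat.cast_le (α := ℝ)).2 hc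
        push_cast at hc'
        have hB0' : (0 : ℝ) < B := by exact_mod_cast hB1
        have t1 := excess_tail (G.neighborFinset v) C M B hM1 (by
          have hd : (#(G.neighborFinset v) : ℝ) ≤ D := by
            rw [G.card_neighborFinset_eq_degree]; exact_mod_cast hdeg v
          have hs : ((C : ℝ) / M) = 1 / 1536 := by
            rw [hM, hD, hC]; push_cast; field_simp; norm_num
          rw [hs]
          calc _ ≤ (D : ℝ) * (1 / 1536) ^ 2 := by gcongr
            _ = B := by rw [hD]; push_cast; ring
            _ ≤ _ := le_refl _)
        have t2 := success_tail (V := V) C M B 2304 hM1 (by norm_num)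
          (fun η => ∃ x ∈ G.neighborFinset v, ∃ y ∈ G.neighborFinset v, x ≠ y ∧
            ((η x).val = 0 ∧ ∀ z, G.Adj x z → (η z).val ≠ 0) ∧
            ((η y).val = 0 ∧ ∀ z, G.Adj y z → (η z).val ≠ 0))
          (success_prob G v D M (by omega) hM hdeg hP _ (fun η h => h)) hC
        have t2' : (#({ω : V → Fin C → Fin M | #{c | ∃ x ∈ G.neighborFinset v,
              ∃ y ∈ G.neighborFinset v, x ≠ y ∧ Ret G ω x c ∧ Ret G ω y c} ≤ 2 * B} :
              Finset (V → Fin C → Fin M)) : ℝ) ≤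
              (4 / Real.exp 2) ^ B * Fintype.card (V → Fin C → Fin M) := by
          refine le_trans ((Nat.cast_le (α := ℝ)).2 (card_le_card ?_)) t2
          intro ω hω
          simp only [mem_filter, mem_univ, true_and] at hω ⊢
          refine le_trans (card_le_card ?_) hω
          intro c
          simp only [mem_filter, mem_univ, true_and]
          exact fun h => h
        have hc'' := hc'.trans (add_le_add t1 t2')
        clear t1 t2 t2' hc' hc hsub
        have hfin : ((4 * (D + 1) ^ 4 * #(univ.filter (fun ω => ¬ ok v ω)) : ℕ) : ℝ)
            ≤ (Fintype.card (V → Fin C → Fin M) : ℕ) := by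
          push_cast
          calc _ ≤ 4 * ((D : ℝ) + 1) ^ 4 *
                ((Real.exp (1 / 2) / 2) ^ B * Fintype.card (V → Fin C → Fin M) +
                  (4 / Real.exp 2) ^ B * Fintype.card (V → Fin C → Fin M)) := by
                gcongr
            _ = (4 * ((D + 1 : ℕ) : ℝ) ^ 4 *
                  ((Real.exp (1 / 2) / 2) ^ B + (4 / Real.exp 2) ^ B)) *
                  Fintype.card (V → Fin C → Fin M) := by push_cast; ring
            _ ≤ 1 * Fintype.card (V → Fin C → Fin M) := by gcongr
            _ = _ := by simp
        exact_mod_cast hfin)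
  have hω' : ∀ v, ok v ω := by
    intro v
    have := hω v
    simpa only [mem_filter, mem_univ, true_and, not_not] using this
  let dom : Finset V := univ.filter (fun x => ∃ c, Ret G ω x c)
  have hdom : ∀ x, x ∈ dom ↔ ∃ c, Ret G ω x c := by intro x; simp [dom]
  have hC0 : 0 < C := by omega
  let κ0 : V → Fin C := fun x => if h : ∃ c, Ret G ω x c then h.choose else ⟨0, hC0⟩
  have hκ0 : ∀ x ∈ dom, Ret G ω x (κ0 x) := by
    intro x hx
    have h := (hdom x).1 hx
    simp only [κ0, dif_pos h]
    exact h.choose_spec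
  have hCK : C ≤ D - B := by omega
  apply greedy_extend G (D - B) dom (fun x => Fin.castLE hCK (κ0 x))
  · intro x hx y hy hxy heq
    have heq' : κ0 x = κ0 y := Fin.castLE_injective hCK heq
    have h1 := hκ0 x hx
    have h2 := hκ0 y hy
    rw [← heq'] at h2
    exact h1.2 y hxy h2.1
  · intro v _
    have him : #((G.neighborFinset v ∩ dom).image (fun x => Fin.castLE hCK (κ0 x)))
        = #((G.neighborFinset v ∩ dom).image κ0) := by
      rw [← Finset.card_image_of_injective _ (Fin.castLE_injective hCK), image_image]
      rfl
    rw [him]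
    have hsplit := Finset.card_inter_add_card_sdiff (G.neighborFinset v) dom
    rw [G.card_neighborFinset_eq_degree] at hsplit
    have hdv := hdeg v
    rcases hω' v with h | ⟨h1, h2⟩
    · have := card_image_le (s := G.neighborFinset v ∩ dom) (f := κ0)
      omega
    · have hs := savings (G.neighborFinset v) C (Ret G ω) (fun x => #{c | (ω x c).val = 0})
        (fun x => card_le_card (by
          intro c
          simp only [mem_filter, mem_univ, true_and]
          exact fun h => h.1)) dom hdom κ0 hκ0
      omega

/-! ### Neighbourhoods in the square of the line graph are sparse -/

theorem card_pairs_left {E : Type*} [DecidableEq E] (S : Finset E) (R : E → E → Prop)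
    [∀ f g, Decidable (R f g)] :
    #{p ∈ S ×ˢ S | R p.1 p.2} = ∑ f ∈ S, #{g ∈ S | R f g} := by
  rw [card_filter, sum_product]
  apply sum_congr rfl
  intro f _
  rw [card_filter]

theorem card_pairs_right {E : Type*} [DecidableEq E] (S : Finset E) (R : E → E → Prop)
    [∀ f g, Decidable (R f g)] :
    #{p ∈ S ×ˢ S | R p.1 p.2} = ∑ g ∈ S, #{f ∈ S | R f g} := by
  rw [card_filter, sum_product_right]
  apply sum_congr rfl
  intro f _
  rw [card_filter]

theorem card_preim_le {E V : Type*} [DecidableEq E] [DecidableEq V] (S : Finset E) (φ : E → V)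
    (Q : Finset V) (Δ : ℕ) (h : ∀ x, #{f ∈ S | φ f = x} ≤ Δ) :
    #{f ∈ S | φ f ∈ Q} ≤ #Q * Δ := by
  have hm : ∀ f ∈ ({f ∈ S | φ f ∈ Q} : Finset E), φ f ∈ Q := fun f hf => (mem_filter.1 hf).2
  rw [card_eq_sum_card_fiberwise hm]
  calc _ ≤ ∑ x ∈ Q, Δ := by
        apply sum_le_sum
        intro x _
        refine le_trans (card_le_card ?_) (h x)
        intro f
        simp only [mem_filter]
        tauto
    _ = _ := by simp

/-- Adjacency of vertices in the multigraph. -/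
def Adjv {V E : Type*} (ends : E → Sym2 V) (x y : V) : Prop := ∃ h : E, ends h = s(x, y)

theorem Adjv.symm {V E : Type*} {ends : E → Sym2 V} {x y : V} (h : Adjv ends x y) :
    Adjv ends y x := by
  obtain ⟨e, he⟩ := h
  exact ⟨e, by rw [he, Sym2.eq_swap]⟩

open Classical in
theorem nbr_card {V E : Type*} [Fintype E] (ends : E → Sym2 V) (x : V) (T : Finset V) :
    #{y ∈ T | Adjv ends x y} ≤ #{f | ∃ y ∈ T, ends f = s(x, y)} := by
  rcases Finset.eq_empty_or_nonempty ({y ∈ T | Adjv ends x y} : Finset V) with h0 | ⟨y0, hy0⟩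
  · rw [h0]; simp
  have hE : Nonempty E := ⟨(mem_filter.1 hy0).2.choose⟩
  have hch : ∀ y ∈ ({y ∈ T | Adjv ends x y} : Finset V), ∃ f : E, ends f = s(x, y) := by
    intro y hy
    exact (mem_filter.1 hy).2
  choose! φ hφ using hch
  apply Finset.card_le_card_of_injOn φ
  · intro y hy
    have hy' := mem_coe.1 hy
    simp only [coe_filter, mem_univ, true_and, Set.mem_ofPred_eq]
    exact ⟨y, (mem_filter.1 hy').1, hφ y hy'⟩
  · intro y hy z hz h
    have h1 := hφ y (mem_coe.1 hy)
    have h2 := hφ z (mem_coe.1 hz)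
    rw [h, h2] at h1
    exact (Sym2.congr_right.1 h1).symm

open Classical in
theorem sparse_pairs {V E : Type*} [Fintype V] [Fintype E] (ends : E → Sym2 V)
    (hloop : ∀ e, ¬ (ends e).IsDiag) (Δ : ℕ) (hΔ : 1 ≤ Δ)
    (hdeg : ∀ v, #{e | v ∈ ends e} ≤ Δ) (W : Finset V) (hW : #W ≤ 2 * Δ)
    (hS : 63 * Δ ^ 2 ≤ 32 * #{f | ∃ x ∈ W, x ∈ ends f}) :
    Δ ^ 4 ≤ 2 * #{p ∈ ({f | ∃ x ∈ W, x ∈ ends f} : Finset E) ×ˢ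
        ({f | ∃ x ∈ W, x ∈ ends f} : Finset E) |
      ¬ ∃ x ∈ ends p.1, ∃ y ∈ ends p.2, x = y ∨ Adjv ends x y} := by
  set S : Finset E := {f | ∃ x ∈ W, x ∈ ends f} with hSdef
  set S' : Finset E := {f | ∃ x ∈ W, ∃ y, y ∉ W ∧ ends f = s(x, y)} with hS'def
  have hpos : 0 < #S := by
    have : 0 < Δ ^ 2 := by positivity
    omega
  obtain ⟨e0, he0⟩ := card_pos.1 hpos
  have hE : Nonempty E := ⟨e0⟩
  have hV : Nonempty V := ⟨(mem_filter.1 he0).2.choose⟩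
  have hch : ∀ f ∈ S', ∃ x y, x ∈ W ∧ y ∉ W ∧ ends f = s(x, y) := by
    intro f hf
    obtain ⟨x, hx, y, hy, h⟩ := (mem_filter.1 hf).2
    exact ⟨x, y, hx, hy, h⟩
  choose! a b haW hbW hab using hch
  have hsub : S' ⊆ S := by
    intro f hf
    refine mem_filter.2 ⟨mem_univ _, a f, haW f hf, ?_⟩
    rw [hab f hf]; simp
  have hfa : ∀ x, #{f ∈ S' | a f = x} ≤ Δ := by
    intro x
    refine le_trans (card_le_card ?_) (hdeg x)
    intro f hf
    obtain ⟨h1, h2⟩ := mem_filter.1 hf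
    refine mem_filter.2 ⟨mem_univ _, ?_⟩
    rw [hab f h1, h2]; simp
  have hfb : ∀ x, #{f ∈ S' | b f = x} ≤ Δ := by
    intro x
    refine le_trans (card_le_card ?_) (hdeg x)
    intro f hf
    obtain ⟨h1, h2⟩ := mem_filter.1 hf
    refine mem_filter.2 ⟨mem_univ _, ?_⟩
    rw [hab f h1, h2]; simp
  -- number of neighbours inside `W`
  let n : V → ℕ := fun x => #{y ∈ W | Adjv ends x y}
  have hin : ∀ x ∈ W, #{f ∈ S' | a f = x} + n x ≤ Δ := by
    intro x hx
    refine le_trans (Nat.add_le_add_left (nbr_card ends x W) _) ?_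
    rw [← card_union_of_disjoint]
    · refine le_trans (card_le_card ?_) (hdeg x)
      intro f hf
      refine mem_filter.2 ⟨mem_univ _, ?_⟩
      rcases mem_union.1 hf with h | h
      · obtain ⟨h1, h2⟩ := mem_filter.1 h
        rw [hab f h1, h2]; simp
      · obtain ⟨y, _, h2⟩ := (mem_filter.1 h).2
        rw [h2]; simp
    · rw [disjoint_left]
      intro f hf hf'
      obtain ⟨h1, h2⟩ := mem_filter.1 hf
      obtain ⟨y, hy, h3⟩ := (mem_filter.1 hf').2
      have h4 := hab f h1
      rw [h2, h3] at h4
      have h5 := Sym2.congr_right.1 h4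
      exact hbW f h1 (h5 ▸ hy)
  have hout : ∀ x, #{y ∈ Wᶜ | Adjv ends x y} + n x ≤ Δ := by
    intro x
    have h1 := nbr_card ends x univ
    have h2 : #{f | ∃ y ∈ (univ : Finset V), ends f = s(x, y)} ≤ Δ := by
      refine le_trans (card_le_card ?_) (hdeg x)
      intro f hf
      obtain ⟨y, _, h2⟩ := (mem_filter.1 hf).2
      refine mem_filter.2 ⟨mem_univ _, ?_⟩
      rw [h2]; simp
    have h3 : #{y ∈ Wᶜ | Adjv ends x y} + n x = #{y ∈ (univ : Finset V) | Adjv ends x y} := by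
      rw [← card_union_of_disjoint]
      · congr 1
        ext y
        simp only [mem_union, mem_filter, mem_compl, mem_univ, true_and]
        tauto
      · rw [disjoint_left]
        intro y h4 h5
        exact (mem_compl.1 (mem_filter.1 h4).1) (mem_filter.1 h5).1
    omega
  obtain ⟨N, hN⟩ : ∃ N, N = ∑ g ∈ S', n (b g) := ⟨_, rfl⟩
  have hsumW : #S' + ∑ x ∈ W, n x ≤ 2 * Δ ^ 2 := by
    have hm : ∀ f ∈ S', a f ∈ W := haW
    rw [card_eq_sum_card_fiberwise hm, ← sum_add_distrib]
    calc _ ≤ ∑ x ∈ W, Δ := sum_le_sum hin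
      _ = #W * Δ := by simp
      _ ≤ 2 * Δ * Δ := Nat.mul_le_mul_right _ hW
      _ = _ := by ring
  have hs_low : 2 * #S ≤ 2 * Δ ^ 2 + #S' := by
    have h1 : ∑ x ∈ W, #{f | x ∈ ends f} = ∑ f : E, #{x ∈ W | x ∈ ends f} := by
      have := Finset.sum_card_bipartiteAbove_eq_sum_card_bipartiteBelow
        (s := W) (t := (univ : Finset E)) (fun x f => x ∈ ends f)
      simpa only [bipartiteAbove, bipartiteBelow] using this
    have h2 : ∑ x ∈ W, #{f | x ∈ ends f} ≤ 2 * Δ ^ 2 := by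
      calc _ ≤ ∑ x ∈ W, Δ := sum_le_sum (fun x _ => hdeg x)
        _ = #W * Δ := by simp
        _ ≤ 2 * Δ * Δ := Nat.mul_le_mul_right _ hW
        _ = _ := by ring
    have h3 : ∑ f ∈ S, 2 ≤ ∑ f ∈ S, (#{x ∈ W | x ∈ ends f} + if f ∈ S' then 1 else 0) := by
      apply sum_le_sum
      intro f hf
      obtain ⟨x, hx, hxf⟩ := (mem_filter.1 hf).2
      obtain ⟨y, hy⟩ := hxf
      have hx1 : x ∈ ({x ∈ W | x ∈ ends f} : Finset V) := mem_filter.2 ⟨hx, by rw [hy]; simp⟩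
      by_cases hyW : y ∈ W
      · have hy1 : y ∈ ({x ∈ W | x ∈ ends f} : Finset V) := mem_filter.2 ⟨hyW, by rw [hy]; simp⟩
        have hxy : x ≠ y := by
          rintro rfl
          apply hloop f
          rw [hy]; simp
        have : 2 ≤ #{x ∈ W | x ∈ ends f} := by
          rw [← card_pair hxy]
          apply card_le_card
          intro z hz
          rcases mem_insert.1 hz with rfl | hz
          · exact hx1
          · rw [mem_singleton.1 hz]; exact hy1
        omega
      · have hfS : f ∈ S' := mem_filter.2 ⟨mem_univ _, x, hx, y, hyW, hy⟩
        rw [if_pos hfS]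
        have : 0 < #{x ∈ W | x ∈ ends f} := card_pos.2 ⟨x, hx1⟩
        omega
    rw [sum_add_distrib, ← card_filter, filter_mem_eq_inter, inter_eq_right.2 hsub] at h3
    have h4 : ∑ f ∈ S, #{x ∈ W | x ∈ ends f} ≤ ∑ f : E, #{x ∈ W | x ∈ ends f} :=
      sum_le_sum_of_subset (subset_univ _)
    simp only [sum_const, smul_eq_mul] at h3
    omega
  -- the four kinds of close pairs
  let P0 : Finset (E × E) := {p ∈ S' ×ˢ S' | Adjv ends (a p.1) (a p.2)}
  let P1 : Finset (E × E) := {p ∈ S' ×ˢ S' | Adjv ends (b p.2) (a p.1)}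
  let P2 : Finset (E × E) := {p ∈ S' ×ˢ S' | Adjv ends (b p.1) (a p.2)}
  let P3 : Finset (E × E) := {p ∈ S' ×ˢ S' | Adjv ends (b p.1) (b p.2)}
  have hP1 : #P1 ≤ Δ * N := by
    rw [show #P1 = _ from card_pairs_right S' (fun f g => Adjv ends (b g) (a f)), hN, mul_sum]
    apply sum_le_sum
    intro g _
    have := card_preim_le S' a {y ∈ W | Adjv ends (b g) y} Δ hfa
    rw [mul_comm]
    refine le_trans (card_le_card ?_) this
    intro f hf
    obtain ⟨h1, h2⟩ := mem_filter.1 hf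
    exact mem_filter.2 ⟨h1, mem_filter.2 ⟨haW f h1, h2⟩⟩
  have hP2 : #P2 ≤ Δ * N := by
    rw [show #P2 = _ from card_pairs_left S' (fun f g => Adjv ends (b f) (a g)), hN, mul_sum]
    apply sum_le_sum
    intro g _
    have := card_preim_le S' a {y ∈ W | Adjv ends (b g) y} Δ hfa
    rw [mul_comm]
    refine le_trans (card_le_card ?_) this
    intro f hf
    obtain ⟨h1, h2⟩ := mem_filter.1 hf
    exact mem_filter.2 ⟨h1, mem_filter.2 ⟨haW f h1, h2⟩⟩
  have hP3 : #P3 + Δ * N ≤ #S' * Δ ^ 2 := by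
    rw [show #P3 = _ from card_pairs_left S' (fun f g => Adjv ends (b f) (b g)), hN, mul_sum,
      ← sum_add_distrib]
    calc _ ≤ ∑ f ∈ S', Δ ^ 2 := by
          apply sum_le_sum
          intro f _
          have h1 := card_preim_le S' b {y ∈ Wᶜ | Adjv ends (b f) y} Δ hfb
          have h2 : #{g ∈ S' | Adjv ends (b f) (b g)} ≤
              #{g ∈ S' | b g ∈ ({y ∈ Wᶜ | Adjv ends (b f) y} : Finset V)} := by
            apply card_le_card
            intro g hg
            obtain ⟨h1, h2⟩ := mem_filter.1 hg
            exact mem_filter.2 ⟨h1, mem_filter.2 ⟨mem_compl.2 (hbW g h1), h2⟩⟩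
          have h3 := Nat.mul_le_mul_right Δ (hout (b f))
          nlinarith
      _ = _ := by simp
  have hP0 : #P0 + Δ ^ 2 * #S' ≤ 2 * Δ ^ 4 := by
    have h1 : #P0 ≤ Δ * ∑ f ∈ S', n (a f) := by
      rw [show #P0 = _ from card_pairs_left S' (fun f g => Adjv ends (a f) (a g)), mul_sum]
      apply sum_le_sum
      intro g _
      have := card_preim_le S' a {y ∈ W | Adjv ends (a g) y} Δ hfa
      rw [mul_comm]
      refine le_trans (card_le_card ?_) this
      intro f hf
      obtain ⟨h1, h2⟩ := mem_filter.1 hf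
      exact mem_filter.2 ⟨h1, mem_filter.2 ⟨haW f h1, h2⟩⟩
    have h2 : ∑ f ∈ S', n (a f) ≤ Δ * ∑ x ∈ W, n x := by
      have hm : ∀ f ∈ S', a f ∈ W := haW
      rw [← sum_fiberwise_of_maps_to hm, mul_sum]
      apply sum_le_sum
      intro x _
      rw [sum_congr rfl (g := fun _ => n x) (fun f hf => by rw [(mem_filter.1 hf).2]), sum_const,
        smul_eq_mul]
      exact Nat.mul_le_mul_right _ (hfa x)
    have h3 := Nat.mul_le_mul_left Δ h2
    have h4 := Nat.mul_le_mul_left (Δ ^ 2) hsumW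
    nlinarith
  have hP12 : N ^ 4 ≤ 16 * Δ ^ 8 * #(P1 ∩ P2) := by
    let k2 : V × V → ℕ := fun p => #{y ∈ Wᶜ | Adjv ends p.1 y ∧ Adjv ends p.2 y}
    have c1 : ∑ p ∈ W ×ˢ W, k2 p ^ 2 ≤ #(P1 ∩ P2) := by
      let Q : Finset ((V × V) × (V × V)) := {q ∈ (W ×ˢ W) ×ˢ (Wᶜ ×ˢ Wᶜ) |
        (Adjv ends q.1.1 q.2.1 ∧ Adjv ends q.1.2 q.2.1) ∧
        (Adjv ends q.1.1 q.2.2 ∧ Adjv ends q.1.2 q.2.2)}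
      have hQ : #Q = ∑ p ∈ W ×ˢ W, k2 p ^ 2 := by
        simp only [Q]
        rw [card_filter, sum_product]
        apply sum_congr rfl
        intro p _
        rw [← card_filter, sq]
        simp only [k2]
        rw [← card_product, ← filter_product]
      rw [← hQ]
      have hed : ∀ x y, Adjv ends x y → ∃ f, ends f = s(x, y) := fun x y h => h
      choose! ed hed using hed
      have hedS : ∀ x y, x ∈ W → y ∉ W → Adjv ends x y →
          ed x y ∈ S' ∧ a (ed x y) = x ∧ b (ed x y) = y := by
        intro x y hx hy h
        have h1 := hed x y h
        have h2 : ed x y ∈ S' := mem_filter.2 ⟨mem_univ _, x, hx, y, hy, h1⟩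
        have h3 := hab _ h2
        rw [h1, Sym2.eq_iff] at h3
        have h4 := haW _ h2
        have h5 := hbW _ h2
        rcases h3 with ⟨h6, h7⟩ | ⟨h6, h7⟩
        · exact ⟨h2, h6.symm, h7.symm⟩
        · exact absurd hx (h6 ▸ h5)
      have hQm : ∀ q ∈ Q, q.1.1 ∈ W ∧ q.1.2 ∈ W ∧ q.2.1 ∉ W ∧ q.2.2 ∉ W ∧
          Adjv ends q.1.1 q.2.1 ∧ Adjv ends q.1.2 q.2.1 ∧
          Adjv ends q.1.1 q.2.2 ∧ Adjv ends q.1.2 q.2.2 := by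
        intro q hq
        simp only [Q, mem_filter, mem_product, mem_compl] at hq
        tauto
      apply card_le_card_of_injOn (fun q => (ed q.1.1 q.2.1, ed q.1.2 q.2.2))
      · intro q hq
        obtain ⟨w1, w2, w3, w4, a1, a2, a3, a4⟩ := hQm q (mem_coe.1 hq)
        obtain ⟨s1, s2, s3⟩ := hedS _ _ w1 w3 a1
        obtain ⟨t1, t2, t3⟩ := hedS _ _ w2 w4 a4
        apply mem_coe.2
        simp only [P1, P2, mem_inter, mem_filter, mem_product]
        rw [s2, s3, t2, t3]
        exact ⟨⟨⟨s1, t1⟩, a3.symm⟩, ⟨⟨s1, t1⟩, a2.symm⟩⟩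
      · intro q hq q' hq' h
        obtain ⟨w1, w2, w3, w4, a1, a2, a3, a4⟩ := hQm q (mem_coe.1 hq)
        obtain ⟨w1', w2', w3', w4', a1', a2', a3', a4'⟩ := hQm q' (mem_coe.1 hq')
        obtain ⟨s1, s2, s3⟩ := hedS _ _ w1 w3 a1
        obtain ⟨t1, t2, t3⟩ := hedS _ _ w2 w4 a4
        obtain ⟨s1', s2', s3'⟩ := hedS _ _ w1' w3' a1'
        obtain ⟨t1', t2', t3'⟩ := hedS _ _ w2' w4' a4'
        simp only [Prod.mk.injEq] at h
        rw [h.1] at s2 s3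
        rw [h.2] at t2 t3
        refine Prod.ext (Prod.ext ?_ ?_) (Prod.ext ?_ ?_)
        · rw [← s2, s2']
        · rw [← t2, t2']
        · rw [← s3, s3']
        · rw [← t3, t3']
    have c2 : ∑ p ∈ W ×ˢ W, k2 p = ∑ y ∈ Wᶜ, n y ^ 2 := by
      have := Finset.sum_card_bipartiteAbove_eq_sum_card_bipartiteBelow
        (s := W ×ˢ W) (t := Wᶜ) (fun p y => Adjv ends p.1 y ∧ Adjv ends p.2 y)
      simp only [bipartiteAbove, bipartiteBelow] at this
      simp only [k2]
      rw [this]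
      apply sum_congr rfl
      intro y _
      have hfp : ({p ∈ W ×ˢ W | Adjv ends p.1 y ∧ Adjv ends p.2 y} : Finset (V × V)) =
          ({x ∈ W | Adjv ends x y} : Finset V) ×ˢ ({x ∈ W | Adjv ends x y} : Finset V) := by
        ext p
        simp only [mem_filter, mem_product]
        tauto
      rw [hfp, card_product, sq]
      have : ({x ∈ W | Adjv ends x y} : Finset V) = {x ∈ W | Adjv ends y x} := by
        ext x
        simp only [mem_filter]
        exact ⟨fun h => ⟨h.1, h.2.symm⟩, fun h => ⟨h.1, h.2.symm⟩⟩
      rw [this]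
    obtain ⟨Y, hY⟩ : ∃ Y, Y = ∑ y ∈ Wᶜ, n y ^ 2 := ⟨_, rfl⟩
    have c3 : Y ^ 2 ≤ 4 * Δ ^ 2 * #(P1 ∩ P2) := by
      rw [hY, ← c2]
      calc _ ≤ #(W ×ˢ W) * ∑ p ∈ W ×ˢ W, k2 p ^ 2 := sq_sum_le_card_mul_sum_sq
        _ ≤ (2 * Δ * (2 * Δ)) * #(P1 ∩ P2) := by
            rw [card_product]
            gcongr
        _ = _ := by ring
    have c4 : ∑ g ∈ S', n (b g) ^ 2 ≤ Δ * Y := by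
      have hm : ∀ f ∈ S', b f ∈ Wᶜ := fun f hf => mem_compl.2 (hbW f hf)
      rw [hY, ← sum_fiberwise_of_maps_to hm, mul_sum]
      apply sum_le_sum
      intro x _
      rw [sum_congr rfl (g := fun _ => n x ^ 2) (fun f hf => by rw [(mem_filter.1 hf).2]),
        sum_const, smul_eq_mul]
      exact Nat.mul_le_mul_right _ (hfb x)
    have c5 : N ^ 2 ≤ 2 * Δ ^ 3 * Y := by
      rw [hN]
      calc _ ≤ #S' * ∑ g ∈ S', n (b g) ^ 2 := sq_sum_le_card_mul_sum_sq
        _ ≤ (2 * Δ ^ 2) * (Δ * Y) := by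
            gcongr
            omega
        _ = _ := by ring
    calc N ^ 4 = (N ^ 2) ^ 2 := by ring
      _ ≤ (2 * Δ ^ 3 * Y) ^ 2 := by gcongr
      _ = 4 * Δ ^ 6 * Y ^ 2 := by ring
      _ ≤ 4 * Δ ^ 6 * (4 * Δ ^ 2 * #(P1 ∩ P2)) := by gcongr
      _ = _ := by ring
  -- every pair is close or far
  set Far : Finset (E × E) := {p ∈ S ×ˢ S |
      ¬ ∃ x ∈ ends p.1, ∃ y ∈ ends p.2, x = y ∨ Adjv ends x y} with hFar
  have hcov : S' ×ˢ S' ⊆ Far ∪ (P0 ∪ ((P1 ∪ P2) ∪ P3)) := by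
    intro p hp
    obtain ⟨hf, hg⟩ := mem_product.1 hp
    by_cases hfar : p ∈ Far
    · exact mem_union_left _ hfar
    · apply mem_union_right
      have hcl : ∃ x ∈ ends p.1, ∃ y ∈ ends p.2, x = y ∨ Adjv ends x y := by
        by_contra hcon
        exact hfar (mem_filter.2 ⟨mem_product.2 ⟨hsub hf, hsub hg⟩, hcon⟩)
      obtain ⟨x, hx, y, hy, hxy⟩ := hcl
      rw [hab _ hf, Sym2.mem_iff] at hx
      rw [hab _ hg, Sym2.mem_iff] at hy
      have af : Adjv ends (a p.1) (b p.1) := ⟨p.1, hab _ hf⟩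
      have ag : Adjv ends (a p.2) (b p.2) := ⟨p.2, hab _ hg⟩
      have w1 := haW _ hf
      have w2 := haW _ hg
      have w3 := hbW _ hf
      have w4 := hbW _ hg
      simp only [mem_union, P0, P1, P2, P3, mem_filter, hp, true_and]
      rcases hx with rfl | rfl <;> rcases hy with rfl | rfl <;> rcases hxy with h | h
      · right; left; left; rw [h]; exact ag.symm
      · left; exact h
      · exact absurd (h ▸ w1) w4
      · right; left; left; exact h.symm
      · exact absurd (h ▸ w2) w3
      · right; left; right; exact h
      · right; left; left; rw [← h]; exact af.symm
      · right; right; exact h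
  have hcard : #S' * #S' + #(P1 ∩ P2) ≤ #Far + (#P0 + ((#P1 + #P2) + #P3)) := by
    have h0 := card_le_card hcov
    rw [card_product] at h0
    have h1 := card_union_le Far (P0 ∪ ((P1 ∪ P2) ∪ P3))
    have h2 := card_union_le P0 ((P1 ∪ P2) ∪ P3)
    have h3 := card_union_le (P1 ∪ P2) P3
    have h4 := card_union_add_card_inter P1 P2
    omega
  -- numerical conclusion
  have hd0 : (0 : ℝ) < Δ := by exact_mod_cast hΔ
  obtain ⟨x, hx⟩ : ∃ x : ℝ, x = (N : ℝ) / (2 * Δ ^ 3) := ⟨_, rfl⟩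
  have hNx : (N : ℝ) = 2 * Δ ^ 3 * x := by rw [hx]; field_simp
  have r12 : (Δ : ℝ) ^ 4 * x ^ 4 ≤ #(P1 ∩ P2) := by
    have h : (N : ℝ) ^ 4 ≤ 16 * Δ ^ 8 * #(P1 ∩ P2) := by exact_mod_cast hP12
    rw [hNx] at h
    have : 16 * (Δ : ℝ) ^ 8 * (Δ ^ 4 * x ^ 4) ≤ 16 * Δ ^ 8 * #(P1 ∩ P2) := by
      calc _ = (2 * Δ ^ 3 * x) ^ 4 := by ring
        _ ≤ _ := h
    exact le_of_mul_le_mul_left this (by positivity)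
  have r1 : (#P1 : ℝ) ≤ Δ * N := by exact_mod_cast hP1
  have r2 : (#P2 : ℝ) ≤ Δ * N := by exact_mod_cast hP2
  have r3 : (#P3 : ℝ) + Δ * N ≤ #S' * Δ ^ 2 := by exact_mod_cast hP3
  have r0 : (#P0 : ℝ) + Δ ^ 2 * #S' ≤ 2 * Δ ^ 4 := by exact_mod_cast hP0
  have rc : (#S' : ℝ) * #S' + #(P1 ∩ P2) ≤ #Far + (#P0 + ((#P1 + #P2) + #P3)) := by
    exact_mod_cast hcard
  have rs : (31 / 16 : ℝ) * Δ ^ 2 ≤ #S' := by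
    have h1 : 63 * (Δ : ℝ) ^ 2 ≤ 32 * #S := by exact_mod_cast hS
    have h2 : 2 * (#S : ℝ) ≤ 2 * Δ ^ 2 + #S' := by exact_mod_cast hs_low
    linarith
  have rss : (15 / 4 : ℝ) * Δ ^ 4 ≤ #S' * #S' := by
    calc (15 / 4 : ℝ) * Δ ^ 4 ≤ (31 / 16 * Δ ^ 2) * (31 / 16 * Δ ^ 2) := by
          nlinarith [pow_pos hd0 4]
      _ ≤ _ := mul_le_mul rs rs (by positivity) (Nat.cast_nonneg _)
  have rx : (Δ : ℝ) ^ 4 * (2 * x - x ^ 4) ≤ Δ ^ 4 * (5 / 4) := by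
    gcongr
    nlinarith [sq_nonneg (x ^ 2 - 1 / 2), sq_nonneg (x - 1)]
  have rN : (Δ : ℝ) * N = 2 * Δ ^ 4 * x := by rw [hNx]; ring
  have hfin : ((Δ ^ 4 : ℕ) : ℝ) ≤ ((2 * #Far : ℕ) : ℝ) := by
    push_cast
    nlinarith
  exact_mod_cast hfin

/-! ### The final argument -/

/-- The square of the line graph. -/
def lineSq {V E : Type} (ends : E → Sym2 V) : SimpleGraph E where
  Adj f g := f ≠ g ∧ (Share ends f g ∨ ∃ h : E, Share ends f h ∧ Share ends h g)
  symm := ⟨by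
    rintro f g ⟨hne, h⟩
    refine ⟨hne.symm, ?_⟩
    rcases h with ⟨v, h1, h2⟩ | ⟨h, ⟨v, h1, h2⟩, ⟨w, h3, h4⟩⟩
    · exact Or.inl ⟨v, h2, h1⟩
    · exact Or.inr ⟨h, ⟨w, h4, h3⟩, ⟨v, h2, h1⟩⟩⟩
  loopless := ⟨fun f h => h.1 rfl⟩

theorem mem_mem_adjv {V E : Type} (ends : E → Sym2 V) (h : E) (x y : V)
    (hx : x ∈ ends h) (hy : y ∈ ends h) : x = y ∨ Adjv ends x y := by
  by_cases hxy : x = y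
  · exact Or.inl hxy
  · exact Or.inr ⟨h, (Sym2.mem_and_mem_iff hxy).1 ⟨hx, hy⟩⟩

theorem lineSq_close {V E : Type} (ends : E → Sym2 V) {f g : E} (h : (lineSq ends).Adj f g) :
    ∃ x ∈ ends f, ∃ y ∈ ends g, x = y ∨ Adjv ends x y := by
  obtain ⟨_, h⟩ := h
  rcases h with ⟨v, h1, h2⟩ | ⟨h, ⟨v, h1, h2⟩, ⟨w, h3, h4⟩⟩
  · exact ⟨v, h1, v, h2, Or.inl rfl⟩
  · exact ⟨v, h1, w, h4, mem_mem_adjv ends h v w h2 h3⟩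

open Classical in
theorem lineSq_local {V E : Type} [Fintype V] [Fintype E] (ends : E → Sym2 V)
    (hloop : ∀ e, ¬ (ends e).IsDiag) (Δ : ℕ)
    (hdeg : ∀ v, #{e | v ∈ ends e} ≤ Δ) (e : E) :
    ∃ W : Finset V, #W ≤ 2 * Δ ∧ #{f | ∃ x ∈ W, x ∈ ends f} ≤ 2 * Δ ^ 2 ∧
      (lineSq ends).degree e ≤ #{f | ∃ x ∈ W, x ∈ ends f} + Δ ∧
      ({f | ∃ x ∈ W, x ∈ ends f} : Finset E) ⊆ (lineSq ends).neighborFinset e := by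
  obtain ⟨u, v, huv⟩ : ∃ u v, ends e = s(u, v) := by
    induction h : ends e with
    | h a b => exact ⟨a, b, rfl⟩
  have hn : ∀ u, #{y | Adjv ends u y} ≤ Δ := by
    intro u
    refine le_trans (nbr_card ends u univ) (le_trans (card_le_card ?_) (hdeg u))
    intro f
    simp only [mem_filter, mem_univ, true_and]
    rintro ⟨y, hy⟩
    rw [hy]; exact Sym2.mem_mk_left u y
  obtain ⟨W, hWd⟩ : ∃ W : Finset V,
      W = ({x | (Adjv ends u x ∨ Adjv ends v x) ∧ x ≠ u ∧ x ≠ v} : Finset V) := ⟨_, rfl⟩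
  have hmW : ∀ x, x ∈ W ↔ (Adjv ends u x ∨ Adjv ends v x) ∧ x ≠ u ∧ x ≠ v := by
    intro x; rw [hWd]; simp only [mem_filter, mem_univ, true_and]
  have hW : #W ≤ 2 * Δ := by
    have h1 : W ⊆ ({y | Adjv ends u y} : Finset V) ∪ ({y | Adjv ends v y} : Finset V) := by
      intro x hx
      have := ((hmW x).1 hx).1
      simp only [mem_union, mem_filter, mem_univ, true_and]
      exact this
    have h2 := card_le_card h1
    have h3 := card_union_le ({y | Adjv ends u y} : Finset V) ({y | Adjv ends v y} : Finset V)
    have h4 := hn u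
    have h5 := hn v
    omega
  refine ⟨W, hW, ?_, ?_, ?_⟩
  · have h1 : ({f | ∃ x ∈ W, x ∈ ends f} : Finset E) ⊆
        W.biUnion (fun x => ({f | x ∈ ends f} : Finset E)) := by
      intro f hf
      obtain ⟨x, hx, hxf⟩ := (mem_filter.1 hf).2
      exact mem_biUnion.2 ⟨x, hx, mem_filter.2 ⟨mem_univ _, hxf⟩⟩
    calc _ ≤ #W * Δ := le_trans (card_le_card h1) (card_biUnion_le_card_mul _ _ _ fun x _ => hdeg x)
      _ ≤ (2 * Δ) * Δ := Nat.mul_le_mul_right _ hW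
      _ = _ := by ring
  · rw [← SimpleGraph.card_neighborFinset_eq_degree]
    have hsub : (lineSq ends).neighborFinset e ⊆
        ({f | ∃ x ∈ W, x ∈ ends f} : Finset E) ∪ ({f | u ∈ ends f} : Finset E) := by
      intro f hf
      rw [SimpleGraph.mem_neighborFinset] at hf
      simp only [mem_union, mem_filter, mem_univ, true_and]
      by_cases hu : u ∈ ends f
      · exact Or.inr hu
      left
      have hvcase : v ∈ ends f → ∃ x ∈ W, x ∈ ends f := by
        intro hv
        obtain ⟨y, hy⟩ := hv
        have hyf : y ∈ ends f := by rw [hy]; exact Sym2.mem_mk_right v y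
        refine ⟨y, (hmW y).2 ⟨Or.inr ⟨f, hy⟩, ?_, ?_⟩, hyf⟩
        · rintro rfl; exact hu hyf
        · rintro rfl; exact hloop f (by rw [hy]; exact Sym2.mk_isDiag_iff.2 rfl)
      obtain ⟨x, hx, y, hy, hxy⟩ := lineSq_close ends hf
      rw [huv, Sym2.mem_iff] at hx
      by_cases hyu : y = u
      · exact absurd (hyu ▸ hy) hu
      by_cases hyv : y = v
      · exact hvcase (hyv ▸ hy)
      rcases hxy with rfl | hxy
      · tauto
      · refine ⟨y, (hmW y).2 ⟨?_, hyu, hyv⟩, hy⟩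
        rcases hx with rfl | rfl
        · exact Or.inl hxy
        · exact Or.inr hxy
    have h2 := card_le_card hsub
    have h3 := card_union_le ({f | ∃ x ∈ W, x ∈ ends f} : Finset E) ({f | u ∈ ends f} : Finset E)
    have h4 := hdeg u
    omega
  · intro f hf
    obtain ⟨x, hx, hxf⟩ := (mem_filter.1 hf).2
    rw [SimpleGraph.mem_neighborFinset]
    obtain ⟨h1, h2, h3⟩ := (hmW x).1 hx
    refine ⟨?_, Or.inr ?_⟩
    · rintro rfl
      rw [huv, Sym2.mem_iff] at hxf
      tauto
    · rcases h1 with ⟨h, hh⟩ | ⟨h, hh⟩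
      · exact ⟨h, ⟨u, by rw [huv]; exact Sym2.mem_mk_left u v, by rw [hh]; exact Sym2.mem_mk_left u x⟩,
          ⟨x, by rw [hh]; exact Sym2.mem_mk_right u x, hxf⟩⟩
      · exact ⟨h, ⟨v, by rw [huv]; exact Sym2.mem_mk_right u v, by rw [hh]; exact Sym2.mem_mk_left v x⟩,
          ⟨x, by rw [hh]; exact Sym2.mem_mk_right v x, hxf⟩⟩

theorem stmt_12 :
    ∃ ε : ℝ, 0 < ε ∧ ∃ Δ₀ : ℕ,
      ∀ (V E : Type) [Fintype V] [Fintype E] (ends : E → Sym2 V),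
        (∀ e : E, ¬(ends e).IsDiag) →
        ∀ Δ : ℕ, Δ = Finset.univ.sup (fun v : V => mDeg ends v) → Δ₀ ≤ Δ →
          ∃ n : ℕ, (n : ℝ) ≤ (2 - ε) * (Δ : ℝ) ^ 2 ∧
            ∃ c : E → Fin n, IsStrongEdgeColouring ends n c := by
  classical
  obtain ⟨B0, hB0⟩ := sparse_colouring
  refine ⟨1 / 2359296, by norm_num, B0 + 100000000, ?_⟩
  intro V E _ _ ends hloop Δ hΔ hbig
  have hdeg : ∀ v, #{e | v ∈ ends e} ≤ Δ := by
    intro v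
    have h1 : mDeg ends v ≤ Δ := by
      rw [hΔ]
      exact Finset.le_sup (f := fun v : V => mDeg ends v) (mem_univ v)
    refine le_trans (le_of_eq ?_) h1
    rw [mDeg, ← Set.ncard_coe_finset]
    congr 1
    ext e
    simp
  obtain ⟨B, hB⟩ : ∃ B, B = (2 * Δ ^ 2 + Δ) / 2359296 + 1 := ⟨_, rfl⟩
  have hsq : 100000000 * Δ ≤ Δ ^ 2 := by
    rw [sq]; exact Nat.mul_le_mul_right _ (by omega)
  have hD1 : 2 * Δ ^ 2 + Δ < 2359296 * B := by omega
  have hD2 : 2359296 * B ≤ 2 * Δ ^ 2 + Δ + 2359296 := by omega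
  have hD3 : 2 * (2359296 * B) ≤ 5 * Δ ^ 2 := by omega
  have hBB : B0 ≤ B := by omega
  obtain ⟨c, hc⟩ := hB0 B hBB E (lineSq ends) (by
    intro e
    obtain ⟨W, h1, h2, h3, h4⟩ := lineSq_local ends hloop Δ hdeg e
    omega) (by
    intro e
    obtain ⟨W, h1, h2, h3, h4⟩ := lineSq_local ends hloop Δ hdeg e
    by_cases hcase : (lineSq ends).degree e + B < 2359296 * B
    · exact Or.inl hcase
    right
    have hS : 63 * Δ ^ 2 ≤ 32 * #{f | ∃ x ∈ W, x ∈ ends f} := by omega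
    have hsp := sparse_pairs ends hloop Δ (by omega) hdeg W h1 hS
    have hle : #{p ∈ ({f | ∃ x ∈ W, x ∈ ends f} : Finset E) ×ˢ
        ({f | ∃ x ∈ W, x ∈ ends f} : Finset E) |
        ¬ ∃ x ∈ ends p.1, ∃ y ∈ ends p.2, x = y ∨ Adjv ends x y} ≤
        #{p ∈ (lineSq ends).neighborFinset e ×ˢ (lineSq ends).neighborFinset e |
          p.1 ≠ p.2 ∧ ¬ (lineSq ends).Adj p.1 p.2} := by
      apply card_le_card
      intro p hp
      obtain ⟨hp1, hp2⟩ := mem_filter.1 hp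
      obtain ⟨hp3, hp4⟩ := mem_product.1 hp1
      refine mem_filter.2 ⟨mem_product.2 ⟨h4 hp3, h4 hp4⟩, ?_, fun hadj => hp2 (lineSq_close ends hadj)⟩
      intro heq
      obtain ⟨x, _, hx⟩ := (mem_filter.1 hp3).2
      exact hp2 ⟨x, hx, x, heq ▸ hx, Or.inl rfl⟩
    have hsqD : (2 * (2359296 * B)) ^ 2 ≤ (5 * Δ ^ 2) ^ 2 := Nat.pow_le_pow_left hD3 2
    have e1 : (2 * (2359296 * B)) ^ 2 = 4 * (2359296 * B) ^ 2 := by ring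
    have e2 : (5 * Δ ^ 2) ^ 2 = 25 * Δ ^ 4 := by ring
    rw [e1, e2] at hsqD
    generalize (2359296 * B) ^ 2 = Q at *
    omega)
  refine ⟨2359296 * B - B, ?_, c, ?_⟩
  · have hn : 2359296 * (2359296 * B - B) + Δ ^ 2 ≤ 2359296 * (2 * Δ ^ 2) := by omega
    have hn' : (2359296 : ℝ) * ((2359296 * B - B : ℕ) : ℝ) + (Δ : ℝ) ^ 2
        ≤ 2359296 * (2 * (Δ : ℝ) ^ 2) := by exact_mod_cast hn
    linarith
  · intro e f hne h
    exact hc e f ⟨hne, h⟩
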